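/- arXiv:1911.10733 — 6 statements merged into one kernel-verified Lean document; each statement's English description precedes it below -/
import Mathlib

section
/- Let 0 < m < M be real numbers and α > 0. Define F : [m, M] → ℝ by F(t) = t − α·M·m/(M + m − t). Then F(t) ≤ β(m, M, α) for every t ∈ [m, M], and this bound is attained, i.e. max_{t ∈ [m,M]} F(t) = β(m, M, α). -/
noncomputable section

/-- The constant `β(m, M, α)`. -/
def betaConst (m M α : ℝ) : ℝ :=
  if m ≤ Real.sqrt (α * M * m) ∧ Real.sqrt (α * M * m) ≤ M then
    M + m - 2 * Real.sqrt (α * M * m)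
  else if M ≤ Real.sqrt (α * M * m) then (1 - α) * m
  else (1 - α) * M

/-- For positive `u` and `v`, the sign of `(u + c / u) - (v + c / v)` is that of
`(u - v) * (u * v - c)`. -/
theorem add_div_le_add_div_of_sign {u v c : ℝ} (hu : 0 < u) (hv : 0 < v)
    (h : 0 ≤ (u - v) * (u * v - c)) : v + c / v ≤ u + c / u := by
  have key : u + c / u - (v + c / v) = (u - v) * (u * v - c) / (u * v) := by
    field_simp
    ring
  have : 0 ≤ (u - v) * (u * v - c) / (u * v) := by positivity
  linarith

/-- A point `v ∈ [m, M]` satisfying the sign condition against every `u ∈ [m, M]` gives the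
maximum of `t - c / (M + m - t)` over `[m, M]`. -/
theorem isGreatest_image_sub_div {m M v c : ℝ} (hm : 0 < m) (hmv : m ≤ v) (hvM : v ≤ M)
    (h : ∀ u, m ≤ u → u ≤ M → 0 ≤ (u - v) * (u * v - c)) :
    IsGreatest ((fun t : ℝ => t - c / (M + m - t)) '' Set.Icc m M) (M + m - (v + c / v)) := by
  constructor
  · refine ⟨M + m - v, ⟨by linarith, by linarith⟩, ?_⟩
    simp only [sub_sub_cancel]
    ring
  · rintro _ ⟨t, ⟨hmt, htM⟩, rfl⟩
    have := add_div_le_add_div_of_sign (u := M + m - t) (by linarith) (by linarith)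
      (h (M + m - t) (by linarith) (by linarith))
    dsimp only
    linarith

theorem stmt0 (m M α : ℝ) (hm : 0 < m) (hmM : m < M) (hα : 0 < α) :
    IsGreatest ((fun t : ℝ => t - α * M * m / (M + m - t)) '' Set.Icc m M)
      (betaConst m M α) := by
  have hM : 0 < M := hm.trans hmM
  have hc : 0 < α * M * m := by positivity
  have hs : 0 < √(α * M * m) := Real.sqrt_pos.mpr hc
  have hsq : √(α * M * m) * √(α * M * m) = α * M * m := Real.mul_self_sqrt hc.le
  unfold betaConst
  split_ifs with h₁ h₂
  · convert isGreatest_image_sub_div (c := α * M * m) hm h₁.1 h₁.2 (fun u hu _ => ?_) using 1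
    · rw [Real.div_sqrt]
      ring
    · have : (u - √(α * M * m)) * (u * √(α * M * m) - α * M * m)
          = √(α * M * m) * (u - √(α * M * m)) ^ 2 := by
        linear_combination (√(α * M * m) - u) * -hsq
      rw [this]
      positivity
  · convert isGreatest_image_sub_div (c := α * M * m) hm hmM.le le_rfl (fun u _ hu => ?_) using 1
    · field_simp
      ring
    · refine mul_nonneg_of_nonpos_of_nonpos (by linarith) ?_
      nlinarith
  · have h₃ : √(α * M * m) < m := by
      by_contra! h
      exact h₁ ⟨h, (not_le.mp h₂).le⟩
    convert isGreatest_image_sub_div (c := α * M * m) hm le_rfl hmM.le (fun u hu _ => ?_) using 1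
    · field_simp
      ring
    · refine mul_nonneg (by linarith) ?_
      nlinarith
end
end

section
/- Let Φ : B(H) → B(K) be a unital positive linear map and let A be a positive invertible operator on H with mI ≤ A ≤ MI for some scalars 0 < m < M. Then for every α > 0, Φ(A) − α·Φ(A⁻¹)⁻¹ ≤ β(m, M, α)·I in the Loewner order. -/
noncomputable section

/-- A scalar inequality `p t + q / t ≤ r` on `[a, b]`, with `0 < a`, transfers to every operator
`C` with `a ≤ C ≤ b`. -/
theorem smul_add_smul_inverse_le_of_forall_mem_Icc {E : Type*}
    [NormedAddCommGroup E] [InnerProductSpace ℂ E] [CompleteSpace E]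
    {a b p q r : ℝ} (ha : 0 < a) {C : E →L[ℂ] E}
    (hC1 : a • (1 : E →L[ℂ] E) ≤ C) (hC2 : C ≤ b • (1 : E →L[ℂ] E))
    (h : ∀ t ∈ Set.Icc a b, p * t + q * t⁻¹ ≤ r) :
    p • C + q • Ring.inverse C ≤ r • (1 : E →L[ℂ] E) := by
  have h1 : (0 : E →L[ℂ] E) ≤ a • 1 := smul_nonneg ha.le zero_le_one
  have hsa : IsSelfAdjoint C := (h1.trans hC1).isSelfAdjoint
  rw [← Algebra.algebraMap_eq_smul_one] at hC1 hC2 ⊢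
  have hl := (algebraMap_le_iff_le_spectrum (a := C)).1 hC1
  have hu := (le_algebraMap_iff_spectrum_le (a := C)).1 hC2
  have hne : ∀ t ∈ spectrum ℝ C, t ≠ 0 := fun t ht => (ha.trans_le (hl t ht)).ne'
  have hunit : IsUnit C := by
    rw [← spectrum.zero_notMem_iff ℝ]
    exact fun h0 => hne 0 h0 rfl
  have hcont : ContinuousOn (fun t : ℝ => t⁻¹) (spectrum ℝ C) := continuousOn_id.inv₀ hne
  have hinv : Ring.inverse C = cfc (fun t : ℝ => t⁻¹) C := by
    obtain ⟨u, rfl⟩ := hunit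
    rw [Ring.inverse_unit, cfc_inv_id u]
  have key : p • C + q • Ring.inverse C = cfc (fun t : ℝ => p * t + q * t⁻¹) C := by
    rw [cfc_add (a := C) (fun t : ℝ => p * t) (fun t : ℝ => q * t⁻¹)
      (by fun_prop) (continuousOn_const.mul hcont), cfc_const_mul p _ C (by fun_prop),
      cfc_const_mul q _ C hcont, ← hinv, cfc_id' ℝ C]
  rw [key]
  exact cfc_le_algebraMap _ _ _ (fun t ht => h t ⟨hl t ht, hu t ht⟩)
    ((by fun_prop : ContinuousOn (fun t : ℝ => p * t) _).add (continuousOn_const.mul hcont))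

/-- On `[1 / M, 1 / m]` the function `t ↦ M + m - M m t - α / t` is bounded by `β(m, M, α)`. -/
theorem neg_mul_add_neg_mul_inv_le_betaConst_sub {m M α t : ℝ} (hm : 0 < m) (hmM : m < M)
    (hα : 0 < α) (ht : t ∈ Set.Icc M⁻¹ m⁻¹) :
    -(M * m) * t + -α * t⁻¹ ≤ betaConst m M α - (M + m) := by
  obtain ⟨h1, h2⟩ := ht
  have hM : 0 < M := hm.trans hmM
  have ht0 : 0 < t := (inv_pos.2 hM).trans_le h1
  obtain ⟨x, rfl⟩ : ∃ x, t = x⁻¹ := ⟨t⁻¹, (inv_inv t).symm⟩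
  have hx : 0 < x := inv_pos.1 ht0
  have hxM : x ≤ M := (inv_le_inv₀ hM hx).1 h1
  have hmx : m ≤ x := (inv_le_inv₀ hx hm).1 h2
  have hs : Real.sqrt (α * M * m) ^ 2 = α * M * m := Real.sq_sqrt (by positivity)
  have hs0 := Real.sqrt_nonneg (α * M * m)
  rw [inv_inv]
  suffices H : (M + m - betaConst m M α) * x ≤ M * m + α * x ^ 2 by
    have h3 : -(M * m) * x⁻¹ + -α * x = -((M * m + α * x ^ 2) / x) := by
      field_simp
      ring
    have h4 := (le_div_iff₀ hx).2 H
    linarith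
  unfold betaConst
  set s := Real.sqrt (α * M * m)
  split_ifs with c1 c2
  · have hMm : 0 < M * m := mul_pos hM hm
    have h5 : M * m * (2 * s * x) ≤ M * m * (M * m + α * x ^ 2) := by
      nlinarith [sq_nonneg (M * m - s * x)]
    have := le_of_mul_le_mul_left h5 hMm
    linarith
  · have h6 : M ≤ α * m := by
      have : M * M ≤ M * (α * m) := by nlinarith
      exact le_of_mul_le_mul_left this hM
    have : 0 ≤ (x - m) * (α * x - M) :=
      mul_nonneg (by linarith) (by nlinarith)
    nlinarith
  · have hsm : s ≤ m := by
      by_contra! hlt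
      exact c1 ⟨hlt.le, (not_le.1 c2).le⟩
    have h6 : α * M ≤ m := by
      have : m * (α * M) ≤ m * m := by nlinarith
      exact le_of_mul_le_mul_left this hm
    have : 0 ≤ (M - x) * (m - α * x) :=
      mul_nonneg (by linarith) (by nlinarith)
    nlinarith

theorem stmt1 {H K : Type*}
    [NormedAddCommGroup H] [InnerProductSpace ℂ H] [CompleteSpace H]
    [NormedAddCommGroup K] [InnerProductSpace ℂ K] [CompleteSpace K]
    (m M : ℝ) (hm : 0 < m) (hmM : m < M)
    (A : H →L[ℂ] H) (hA0 : 0 ≤ A) (hAu : IsUnit A)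
    (hA1 : m • (1 : H →L[ℂ] H) ≤ A) (hA2 : A ≤ M • (1 : H →L[ℂ] H))
    (Φ : (H →L[ℂ] H) →ₗ[ℂ] (K →L[ℂ] K))
    (hΦ1 : Φ 1 = 1) (hΦpos : ∀ T : H →L[ℂ] H, 0 ≤ T → 0 ≤ Φ T)
    (α : ℝ) (hα : 0 < α) :
    Φ A - α • Ring.inverse (Φ (Ring.inverse A)) ≤ betaConst m M α • (1 : K →L[ℂ] K) := by
  have hM : 0 < M := hm.trans hmM
  have hmono : ∀ S T : H →L[ℂ] H, S ≤ T → Φ S ≤ Φ T := fun S T h => by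
    rw [← sub_nonneg, ← map_sub]
    exact hΦpos _ (sub_nonneg.2 h)
  have hsmul : ∀ (c : ℝ) (T : H →L[ℂ] H), Φ (c • T) = c • Φ T := fun c T =>
    (Φ.restrictScalars ℝ).map_smul c T
  have e1 := smul_add_smul_inverse_le_of_forall_mem_Icc (p := 1) (q := M * m) (r := M + m)
    hm hA1 hA2 fun t ht => by
      have ht0 : 0 < t := hm.trans_le ht.1
      have h1 : 0 ≤ (t - m) * (M - t) / t :=
        div_nonneg (mul_nonneg (sub_nonneg.2 ht.1) (sub_nonneg.2 ht.2)) ht0.le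
      have h2 : (t - m) * (M - t) / t = M + m - (1 * t + M * m * t⁻¹) := by
        field_simp
        ring
      linarith
  have e2 := smul_add_smul_inverse_le_of_forall_mem_Icc (p := 0) (q := 1) (r := m⁻¹)
    hm hA1 hA2 fun t ht => by
      simpa using (inv_le_inv₀ (hm.trans_le ht.1) hm).2 ht.1
  have e3 := smul_add_smul_inverse_le_of_forall_mem_Icc (p := 0) (q := -1) (r := -M⁻¹)
    hm hA1 hA2 fun t ht => by
      simpa using (inv_le_inv₀ hM (hm.trans_le ht.1)).2 ht.2
  rw [zero_smul, zero_add, one_smul] at e2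
  rw [zero_smul, zero_add, neg_smul, one_smul, neg_smul, neg_le_neg_iff] at e3
  have f1 := hmono _ _ e1
  have f2 := hmono _ _ e2
  have f3 := hmono _ _ e3
  rw [map_add, hsmul, hsmul, hsmul, hΦ1, one_smul] at f1
  rw [hsmul, hΦ1] at f2 f3
  have g := smul_add_smul_inverse_le_of_forall_mem_Icc (inv_pos.2 hM) f3 f2
    fun t ht => neg_mul_add_neg_mul_inv_le_betaConst_sub hm hmM hα ht
  have key := add_le_add f1 g
  rw [← add_smul, add_sub_cancel] at key
  refine le_of_eq_of_le ?_ key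
  module
end
end

section
/- Let A₁, …, Aₙ be positive invertible operators on H with mI ≤ Aⱼ ≤ MI (j = 1, …, n) for some scalars 0 < m < M, let Φ : B(H) → B(K) be a unital positive linear map, and let F (on H) and G (on K) each satisfy the arithmetic–harmonic sandwich for the probability vector ω. Then for every α > 0, G(Φ(A₁), …, Φ(Aₙ)) ≤ α·Φ(F(A₁, …, Aₙ)) + β(m, M, α)·I. -/
noncomputable section

/-- The arithmetic–harmonic sandwich for the probability vector `ω`:
`(∑ ωⱼ Bⱼ⁻¹)⁻¹ ≤ F (B₁, …, Bₙ) ≤ ∑ ωⱼ Bⱼ` for all positive invertible `B₁, …, Bₙ`,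
and `F` takes values in the positive invertible operators. -/
def IsAHSandwich {E : Type*} [NormedAddCommGroup E] [InnerProductSpace ℂ E]
    [CompleteSpace E] {n : ℕ} (ω : Fin n → ℝ)
    (F : (Fin n → (E →L[ℂ] E)) → (E →L[ℂ] E)) : Prop :=
  ∀ B : Fin n → (E →L[ℂ] E), (∀ j, 0 ≤ B j) → (∀ j, IsUnit (B j)) →
    (0 ≤ F B ∧ IsUnit (F B)) ∧
    Ring.inverse (∑ j, ω j • Ring.inverse (B j)) ≤ F B ∧
    F B ≤ ∑ j, ω j • B j

/-- A scalar inequality `0 ≤ p + q x + r x⁻¹` on `[l, u]`, with `0 < l`, lifts to selfadjoint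
elements whose spectrum lies in `[l, u]`. -/
lemma smul_one_add_smul_add_smul_inverse_nonneg {R : Type*} [CStarAlgebra R] [PartialOrder R]
    [StarOrderedRing R] {l u p q r : ℝ} (hl : 0 < l) {a : R} (hla : l • (1 : R) ≤ a)
    (hau : a ≤ u • (1 : R)) (h : ∀ x, l ≤ x → x ≤ u → 0 ≤ p + q * x + r * x⁻¹) :
    0 ≤ p • (1 : R) + q • a + r • Ring.inverse a := by
  have hl1 : (0 : R) ≤ l • (1 : R) := smul_nonneg hl.le zero_le_one
  have ha : IsSelfAdjoint a := .of_nonneg (hl1.trans hla)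
  rw [← Algebra.algebraMap_eq_smul_one] at hla hau
  have h1 := (algebraMap_le_iff_le_spectrum (a := a)).1 hla
  have h2 := (le_algebraMap_iff_spectrum_le (a := a)).1 hau
  have h0 : ∀ x ∈ spectrum ℝ a, x ≠ 0 := fun x hx => (hl.trans_le (h1 x hx)).ne'
  have hu : IsUnit a := (spectrum.zero_notMem_iff ℝ).1 fun hx => h0 0 hx rfl
  have hc : ContinuousOn (fun x : ℝ => x⁻¹) (spectrum ℝ a) :=
    continuousOn_id.inv₀ h0
  have key : cfc (fun x : ℝ => p + q * x + r * x⁻¹) a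
      = p • (1 : R) + q • a + r • Ring.inverse a := by
    rw [cfc_add (a := a) (fun x : ℝ => p + q * x) (fun x => r * x⁻¹),
      cfc_add (a := a) (fun _ : ℝ => p) (fun x => q * x),
      cfc_const p a, cfc_const_mul q (fun x : ℝ => x) a, cfc_const_mul r (fun x : ℝ => x⁻¹) a,
      cfc_id' ℝ a, cfc_ringInverse_id (R := ℝ) a hu, Algebra.algebraMap_eq_smul_one]
  rw [← key]
  exact cfc_nonneg fun x hx => h x (h1 x hx) (h2 x hx)

lemma add_le_mul_add_betaConst_add_div {m M α y : ℝ} (hm : 0 < m) (hmM : m < M) (hα : 0 < α)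
    (hmy : m ≤ y) (hyM : y ≤ M) : M + m ≤ α * y + betaConst m M α + m * M * y⁻¹ := by
  have hy : 0 < y := hm.trans_le hmy
  have hM : 0 < M := hm.trans hmM
  have hs0 := Real.sqrt_nonneg (α * M * m)
  have hs := Real.sq_sqrt (show 0 ≤ α * M * m by positivity)
  unfold betaConst
  set s := Real.sqrt (α * M * m)
  rw [← div_eq_mul_inv, ← sub_le_iff_le_add', le_div_iff₀ hy]
  split_ifs with h1 h2
  · refine le_of_mul_le_mul_left ?_ hα
    nlinarith [sq_nonneg (α * y - s)]
  · have h3 : M ≤ α * m := by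
      refine le_of_mul_le_mul_left ?_ hM
      nlinarith
    have h4 : M ≤ α * y := h3.trans (by gcongr)
    nlinarith [mul_nonneg (sub_nonneg.2 h4) (sub_nonneg.2 hmy)]
  · have hsm : s < m := by
      by_contra! h
      exact h1 ⟨h, (not_le.1 h2).le⟩
    have h3 : α * M ≤ m := by
      refine le_of_mul_le_mul_right ?_ hm
      nlinarith
    have h4 : α * y ≤ m := le_trans (by gcongr) h3
    nlinarith [mul_nonneg (sub_nonneg.2 h4) (sub_nonneg.2 hyM)]

lemma sum_smul_mem_Icc {ι V : Type*} [Fintype ι] [AddCommGroup V] [PartialOrder V]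
    [IsOrderedAddMonoid V] [Module ℝ V] [PosSMulMono ℝ V] {ω : ι → ℝ} (hω0 : ∀ j, 0 ≤ ω j)
    (hω1 : ∑ j, ω j = 1) {a b : V} {x : ι → V} (hx : ∀ j, x j ∈ Set.Icc a b) :
    ∑ j, ω j • x j ∈ Set.Icc a b := by
  have hconst (c : V) : ∑ j, ω j • c = c := by rw [← Finset.sum_smul, hω1, one_smul]
  constructor
  · rw [← hconst a]
    exact Finset.sum_le_sum fun j _ => smul_le_smul_of_nonneg_left (hx j).1 (hω0 j)
  · rw [← hconst b]
    exact Finset.sum_le_sum fun j _ => smul_le_smul_of_nonneg_left (hx j).2 (hω0 j)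

section Kantorovich

variable {R : Type*} [CStarAlgebra R] [PartialOrder R] [StarOrderedRing R] {m M : ℝ}

lemma ringInverse_mem_Icc (hm : 0 < m) {a : R}
    (ha : a ∈ Set.Icc (m • (1 : R)) (M • (1 : R))) :
    Ring.inverse a ∈ Set.Icc (M⁻¹ • (1 : R)) (m⁻¹ • (1 : R)) := by
  constructor
  · have := smul_one_add_smul_add_smul_inverse_nonneg (p := -M⁻¹) (q := 0) (r := 1) hm ha.1 ha.2
      fun x hx hxM => by
        have := inv_anti₀ (hm.trans_le hx) hxM
        linarith
    rw [← sub_nonneg]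
    convert this using 1
    module
  · have := smul_one_add_smul_add_smul_inverse_nonneg (p := m⁻¹) (q := 0) (r := -1) hm ha.1 ha.2
      fun x hx hxM => by
        have := inv_anti₀ hm hx
        linarith
    rw [← sub_nonneg]
    convert this using 1
    module

lemma add_smul_ringInverse_le (hm : 0 < m) {a : R}
    (ha : a ∈ Set.Icc (m • (1 : R)) (M • (1 : R))) :
    a + (m * M) • Ring.inverse a ≤ (M + m) • (1 : R) := by
  have := smul_one_add_smul_add_smul_inverse_nonneg (p := M + m) (q := -1) (r := -(m * M))
    hm ha.1 ha.2 fun x hx hxM => by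
      have hx0 := hm.trans_le hx
      have : 0 ≤ (M - x) * (x - m) * x⁻¹ :=
        mul_nonneg (mul_nonneg (sub_nonneg.2 hxM) (sub_nonneg.2 hx)) (inv_nonneg.2 hx0.le)
      convert this using 1
      field_simp
      ring
  rw [← sub_nonneg]
  convert this using 1
  module

/-- A difference-type converse of the weighted arithmetic–harmonic mean inequality. -/
lemma sum_smul_le_smul_inverse_sum_add (hm : 0 < m) (hmM : m < M) {ι : Type*} [Fintype ι]
    {ω : ι → ℝ} (hω0 : ∀ j, 0 ≤ ω j) (hω1 : ∑ j, ω j = 1) {A : ι → R}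
    (hA : ∀ j, A j ∈ Set.Icc (m • (1 : R)) (M • (1 : R))) {α : ℝ} (hα : 0 < α) :
    ∑ j, ω j • A j ≤ α • Ring.inverse (∑ j, ω j • Ring.inverse (A j))
      + betaConst m M α • (1 : R) := by
  have hM : 0 < M := hm.trans hmM
  have hD := sum_smul_mem_Icc hω0 hω1 fun j => ringInverse_mem_Icc hm (hA j)
  have hB : ∑ j, ω j • A j + (m * M) • ∑ j, ω j • Ring.inverse (A j) ≤ (M + m) • (1 : R) := by
    have := Finset.sum_le_sum fun j (_ : j ∈ Finset.univ) =>
      smul_le_smul_of_nonneg_left (add_smul_ringInverse_le hm (hA j)) (hω0 j)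
    rw [← Finset.sum_smul, hω1, one_smul] at this
    simpa only [smul_add, Finset.sum_add_distrib, Finset.smul_sum, smul_comm (m * M)] using this
  have hX := smul_one_add_smul_add_smul_inverse_nonneg (p := betaConst m M α - (M + m))
    (q := m * M) (r := α) (inv_pos.2 hM) hD.1 hD.2 fun x hx hxm => by
      have hx0 : 0 < x := (inv_pos.2 hM).trans_le hx
      have := add_le_mul_add_betaConst_add_div hm hmM hα ((le_inv_comm₀ hx0 hm).1 hxm)
        ((inv_le_comm₀ hM hx0).1 hx)
      rw [inv_inv] at this
      linarith
  rw [← sub_nonneg] at hB ⊢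
  convert add_nonneg hB hX using 1
  module

end Kantorovich

theorem stmt2
    {H K : Type*}
    [NormedAddCommGroup H] [InnerProductSpace ℂ H] [CompleteSpace H]
    [NormedAddCommGroup K] [InnerProductSpace ℂ K] [CompleteSpace K]
    {n : ℕ} (ω : Fin n → ℝ) (hω0 : ∀ j, 0 ≤ ω j) (hω1 : ∑ j, ω j = 1)
    (m M : ℝ) (hm : 0 < m) (hmM : m < M)
    (A : Fin n → (H →L[ℂ] H))
    (hA0 : ∀ j, 0 ≤ A j) (hAu : ∀ j, IsUnit (A j))
    (hA1 : ∀ j, m • (1 : H →L[ℂ] H) ≤ A j)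
    (hA2 : ∀ j, A j ≤ M • (1 : H →L[ℂ] H))
    (Φ : (H →L[ℂ] H) →ₗ[ℂ] (K →L[ℂ] K))
    (hΦ1 : Φ 1 = 1) (hΦpos : ∀ T : H →L[ℂ] H, 0 ≤ T → 0 ≤ Φ T)
    (F : (Fin n → (H →L[ℂ] H)) → (H →L[ℂ] H))
    (G : (Fin n → (K →L[ℂ] K)) → (K →L[ℂ] K))
    (hF : IsAHSandwich ω F) (hG : IsAHSandwich ω G)
    (α : ℝ) (hα : 0 < α)
    :
    G (fun j => Φ (A j)) ≤ α • Φ (F A) + betaConst m M α • (1 : K →L[ℂ] K) := by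
  have hΦreal (r : ℝ) (T : H →L[ℂ] H) : Φ (r • T) = r • Φ T := Φ.map_smul_of_tower r T
  have hΦmono {S T : H →L[ℂ] H} (h : S ≤ T) : Φ S ≤ Φ T := by
    rw [← sub_nonneg, ← map_sub]
    exact hΦpos _ (sub_nonneg.2 h)
  have hΦA0 (j : Fin n) : 0 ≤ Φ (A j) := hΦpos _ (hA0 j)
  have hΦAu (j : Fin n) : IsUnit (Φ (A j)) := by
    have h : m • (1 : K →L[ℂ] K) ≤ Φ (A j) := by
      simpa only [hΦreal, hΦ1] using hΦmono (hA1 j)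
    refine CStarAlgebra.isUnit_of_le _ h ⟨smul_nonneg hm.le zero_le_one, ?_⟩
    rw [← Algebra.algebraMap_eq_smul_one]
    exact hm.ne'.isUnit.map (algebraMap ℝ (K →L[ℂ] K))
  calc G (fun j => Φ (A j)) ≤ ∑ j, ω j • Φ (A j) := (hG _ hΦA0 hΦAu).2.2
    _ = Φ (∑ j, ω j • A j) := by simp only [map_sum, hΦreal]
    _ ≤ Φ (α • F A + betaConst m M α • 1) := hΦmono <|
        (sum_smul_le_smul_inverse_sum_add hm hmM hω0 hω1 (fun j => ⟨hA1 j, hA2 j⟩) hα).trans <|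
          add_le_add_left (smul_le_smul_of_nonneg_left (hF A hA0 hAu).2.1 hα.le) _
    _ = α • Φ (F A) + betaConst m M α • 1 := by rw [map_add, hΦreal, hΦreal, hΦ1]
end
end

section
/- Let A₁, …, Aₙ be positive invertible operators on H with mI ≤ Aⱼ ≤ MI (j = 1, …, n) for some scalars 0 < m < M, let Φ : B(H) → B(K) be a unital positive linear map, and let F (on H) and G (on K) each satisfy the arithmetic–harmonic sandwich for the probability vector ω. Then G(Φ(A₁), …, Φ(Aₙ)) ≤ Φ(F(A₁, …, Aₙ)) + (√M − √m)²·I. -/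
theorem ringInverse_nonneg {R : Type*} [CStarAlgebra R] [PartialOrder R] [StarOrderedRing R]
    {a : R} (ha : 0 ≤ a) : 0 ≤ Ring.inverse a := by
  by_cases h : IsUnit a
  · obtain ⟨u, rfl⟩ := h
    rw [Ring.inverse_unit]
    exact CFC.inv_nonneg_of_nonneg u ha
  · rw [Ring.inverse_non_unit _ h]

/-- Two-sided bounds on a strictly positive element bound a linear combination of it and its
inverse. -/
theorem add_smul_ringInverse_le_s4 {R : Type*} [CStarAlgebra R] [PartialOrder R] [StarOrderedRing R]
    {m M : ℝ} {a : R} (ha0 : 0 ≤ a) (hau : IsUnit a) (ham : m • (1 : R) ≤ a)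
    (haM : a ≤ M • (1 : R)) :
    a + (m * M) • Ring.inverse a ≤ (M + m) • (1 : R) := by
  obtain ⟨u, rfl⟩ := hau
  rw [Ring.inverse_unit]
  have hi : (0 : R) ≤ ↑u⁻¹ := by
    simpa using ringInverse_nonneg ha0
  have hc : Commute (u : R) (↑u⁻¹ : R) := by simp [Commute, SemiconjBy]
  have h1 : 0 ≤ (M • (1 : R) - u) * ↑u⁻¹ :=
    Commute.mul_nonneg (sub_nonneg.2 haM) hi
      (((Commute.one_left _).smul_left M).sub_left hc)
  have h2 : 0 ≤ ((M • (1 : R) - u) * ↑u⁻¹) * (u - m • (1 : R)) := by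
    refine Commute.mul_nonneg h1 (sub_nonneg.2 ham) ?_
    refine Commute.sub_right ?_ ((Commute.one_right _).smul_right m)
    exact ((((Commute.one_left _).smul_left M).sub_left (Commute.refl _)).mul_left hc.symm)
  rw [← sub_nonneg]
  convert h2 using 1
  simp only [sub_mul, mul_sub, smul_mul_assoc, mul_smul_comm, one_mul, mul_one, Units.mul_inv,
    Units.inv_mul, smul_sub]
  module

theorem isUnit_of_smul_one_le {R : Type*} [CStarAlgebra R] [PartialOrder R] [StarOrderedRing R]
    {m : ℝ} (hm : 0 < m) {a : R} (ha : m • (1 : R) ≤ a) : IsUnit a :=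
  ((isStrictlyPositive_one (A := R)).smul hm |>.of_le ha).isUnit

theorem smul_one_le_ringInverse {R : Type*} [CStarAlgebra R] [PartialOrder R] [StarOrderedRing R]
    {M : ℝ} (hM : 0 < M) {a : R} (ha0 : 0 ≤ a) (hau : IsUnit a) (haM : a ≤ M • (1 : R)) :
    M⁻¹ • (1 : R) ≤ Ring.inverse a := by
  obtain ⟨u, rfl⟩ := hau
  rw [Ring.inverse_unit]
  have hi : (0 : R) ≤ ↑u⁻¹ := by
    simpa using ringInverse_nonneg ha0
  have hc : Commute (u : R) (↑u⁻¹ : R) := by simp [Commute, SemiconjBy]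
  have h1 : 0 ≤ (M • (1 : R) - u) * ↑u⁻¹ :=
    Commute.mul_nonneg (sub_nonneg.2 haM) hi
      (((Commute.one_left _).smul_left M).sub_left hc)
  have h2 := smul_nonneg (inv_nonneg.2 hM.le) h1
  rw [← sub_nonneg]
  convert h2 using 1
  simp [sub_mul, smul_sub, smul_smul, hM.ne']

theorem two_smul_one_le {R : Type*} [CStarAlgebra R] [PartialOrder R] [StarOrderedRing R]
    (s : ℝ) {t : R} (ht0 : 0 ≤ t) (htu : IsUnit t) :
    (2 * s) • (1 : R) ≤ Ring.inverse t + (s ^ 2) • t := by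
  have hi := ringInverse_nonneg ht0
  have hsa : IsSelfAdjoint (s • t - 1) :=
    ((IsSelfAdjoint.all s).smul (IsSelfAdjoint.of_nonneg ht0)).sub (IsSelfAdjoint.one R)
  have h := star_left_conjugate_nonneg hi (s • t - 1)
  rw [hsa.star_eq] at h
  obtain ⟨u, rfl⟩ := htu
  rw [Ring.inverse_unit] at *
  rw [← sub_nonneg]
  convert h using 1
  simp only [sub_mul, mul_sub, smul_mul_assoc, mul_smul_comm, one_mul, mul_one, Units.mul_inv,
    Units.inv_mul, smul_sub]
  module

/-- A reverse arithmetic–harmonic mean inequality with the additive constant `(√M - √m)²`. -/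
theorem sum_smul_le_ringInverse_add {R : Type*} [CStarAlgebra R] [PartialOrder R]
    [StarOrderedRing R] {ι : Type*} [Fintype ι] {ω : ι → ℝ} (hω0 : ∀ j, 0 ≤ ω j)
    (hω1 : ∑ j, ω j = 1) {m M : ℝ} (hm : 0 < m) (hM : 0 < M) {A : ι → R}
    (hA1 : ∀ j, m • (1 : R) ≤ A j) (hA2 : ∀ j, A j ≤ M • (1 : R)) :
    ∑ j, ω j • A j ≤ Ring.inverse (∑ j, ω j • Ring.inverse (A j)) +
      (Real.sqrt M - Real.sqrt m) ^ 2 • (1 : R) := by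
  have hA0 (j) : 0 ≤ A j := (smul_nonneg hm.le zero_le_one).trans (hA1 j)
  have hAu (j) : IsUnit (A j) := isUnit_of_smul_one_le hm (hA1 j)
  have hconst (c : ℝ) : ∑ j, ω j • (c • (1 : R)) = c • (1 : R) := by
    rw [← Finset.sum_smul, hω1, one_smul]
  set T := ∑ j, ω j • Ring.inverse (A j) with hT
  have hTM : M⁻¹ • (1 : R) ≤ T := by
    rw [← hconst]
    exact Finset.sum_le_sum fun j _ => smul_le_smul_of_nonneg_left
      (smul_one_le_ringInverse hM (hA0 j) (hAu j) (hA2 j)) (hω0 j)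
  have hTu : IsUnit T := isUnit_of_smul_one_le (inv_pos.2 hM) hTM
  have hT0 : 0 ≤ T := (smul_nonneg (inv_nonneg.2 hM.le) zero_le_one).trans hTM
  have h1 : ∑ j, ω j • A j + (m * M) • T ≤ (M + m) • (1 : R) := by
    rw [← hconst, hT, Finset.smul_sum, ← Finset.sum_add_distrib]
    refine Finset.sum_le_sum fun j _ => ?_
    rw [smul_comm, ← smul_add]
    exact smul_le_smul_of_nonneg_left
      (add_smul_ringInverse_le_s4 (hA0 j) (hAu j) (hA1 j) (hA2 j)) (hω0 j)
  have h2 := two_smul_one_le (Real.sqrt m * Real.sqrt M) hT0 hTu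
  rw [mul_pow, Real.sq_sqrt hm.le, Real.sq_sqrt hM.le] at h2
  have hc : (Real.sqrt M - Real.sqrt m) ^ 2 = M + m - 2 * (Real.sqrt m * Real.sqrt M) := by
    rw [sub_sq, Real.sq_sqrt hm.le, Real.sq_sqrt hM.le]; ring
  rw [hc, sub_smul, ← sub_nonneg]
  convert add_nonneg (sub_nonneg.2 h1) (sub_nonneg.2 h2) using 1
  abel


noncomputable section

theorem stmt4
    {H K : Type*}
    [NormedAddCommGroup H] [InnerProductSpace ℂ H] [CompleteSpace H]
    [NormedAddCommGroup K] [InnerProductSpace ℂ K] [CompleteSpace K]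
    {n : ℕ} (ω : Fin n → ℝ) (hω0 : ∀ j, 0 ≤ ω j) (hω1 : ∑ j, ω j = 1)
    (m M : ℝ) (hm : 0 < m) (hmM : m < M)
    (A : Fin n → (H →L[ℂ] H))
    (hA0 : ∀ j, 0 ≤ A j) (hAu : ∀ j, IsUnit (A j))
    (hA1 : ∀ j, m • (1 : H →L[ℂ] H) ≤ A j)
    (hA2 : ∀ j, A j ≤ M • (1 : H →L[ℂ] H))
    (Φ : (H →L[ℂ] H) →ₗ[ℂ] (K →L[ℂ] K))
    (hΦ1 : Φ 1 = 1) (hΦpos : ∀ T : H →L[ℂ] H, 0 ≤ T → 0 ≤ Φ T)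
    (F : (Fin n → (H →L[ℂ] H)) → (H →L[ℂ] H))
    (G : (Fin n → (K →L[ℂ] K)) → (K →L[ℂ] K))
    (hF : IsAHSandwich ω F) (hG : IsAHSandwich ω G)
    :
    G (fun j => Φ (A j)) ≤ Φ (F A) + (Real.sqrt M - Real.sqrt m) ^ 2 • (1 : K →L[ℂ] K) := by
  have hmap (c : ℝ) (T : H →L[ℂ] H) : Φ (c • T) = c • Φ T := Φ.map_smul_of_tower c T
  have hmono {S T : H →L[ℂ] H} (h : S ≤ T) : Φ S ≤ Φ T := by
    rw [← sub_nonneg, ← map_sub]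
    exact hΦpos _ (sub_nonneg.2 h)
  have hΦm (j) : m • (1 : K →L[ℂ] K) ≤ Φ (A j) := by
    simpa only [hmap, hΦ1] using hmono (hA1 j)
  calc G (fun j => Φ (A j)) ≤ ∑ j, ω j • Φ (A j) :=
        (hG _ (fun j => hΦpos _ (hA0 j)) fun j => isUnit_of_smul_one_le hm (hΦm j)).2.2
    _ = Φ (∑ j, ω j • A j) := by simp only [map_sum, hmap]
    _ ≤ Φ (F A + (Real.sqrt M - Real.sqrt m) ^ 2 • (1 : H →L[ℂ] H)) :=
        hmono <| (sum_smul_le_ringInverse_add hω0 hω1 hm (hm.trans hmM) hA1 hA2).trans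
          (add_le_add_left (hF A hA0 hAu).2.1 _)
    _ = Φ (F A) + (Real.sqrt M - Real.sqrt m) ^ 2 • (1 : K →L[ℂ] K) := by
        rw [map_add, hmap, hΦ1]
end
end

section
/- Let A₁, …, Aₙ be positive invertible operators on H with mI ≤ Aⱼ ≤ MI (j = 1, …, n) for some scalars 0 < m < M, let Φ : B(H) → B(K) be a unital positive linear map, and let F (on H) and G (on K) each satisfy the arithmetic–harmonic sandwich for the probability vector ω. Then for every α > 0 and every r ∈ (0, 1], G(Φ(A₁ʳ), …, Φ(Aₙʳ)) ≤ α·Φ(F(A₁, …, Aₙ)ʳ) + γ(1/M, 1/m, −r, α)·I. -/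
noncomputable section

/-- The constant `γ(m, M, r, α)`, where real powers are `Real.rpow`. -/
def gammaConst (m M r α : ℝ) : ℝ :=
  if m ≤ ((M ^ r - m ^ r) / (α * r * (M - m))) ^ (1 / (r - 1)) ∧
      ((M ^ r - m ^ r) / (α * r * (M - m))) ^ (1 / (r - 1)) ≤ M then
    α * (r - 1) * ((M ^ r - m ^ r) / (α * r * (M - m))) ^ (r / (r - 1)) +
      (M * m ^ r - m * M ^ r) / (M - m)
  else if M ≤ ((M ^ r - m ^ r) / (α * r * (M - m))) ^ (1 / (r - 1)) then
    (1 - α) * M ^ r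
  else (1 - α) * m ^ r

theorem rpow_tangent_le {x t R : ℝ} (hx : 0 < x) (ht : 0 < t) (hR : R ≤ 0) :
    t ^ R + R * t ^ (R - 1) * (x - t) ≤ x ^ R := by
  have hu : 0 < x / t := div_pos hx ht
  have hlog : Real.log (x / t) ≤ x / t - 1 := Real.log_le_sub_one_of_pos hu
  have hbern : 1 + R * (x / t - 1) ≤ (x / t) ^ R := by
    rw [Real.rpow_def_of_pos hu]
    nlinarith [Real.add_one_le_exp (Real.log (x / t) * R)]
  have hxt : x ^ R = (x / t) ^ R * t ^ R := by
    rw [← Real.mul_rpow hu.le ht.le, div_mul_cancel₀ x ht.ne']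
  calc t ^ R + R * t ^ (R - 1) * (x - t) = (1 + R * (x / t - 1)) * t ^ R := by
        rw [Real.rpow_sub_one ht.ne']; field_simp
    _ ≤ x ^ R := hxt ▸ mul_le_mul_of_nonneg_right hbern (Real.rpow_nonneg ht.le R)

theorem rpow_le_chord {p q x R : ℝ} (hp : 0 < p) (hpq : p < q) (hR : R ≤ 0)
    (hx : x ∈ Set.Icc p q) :
    x ^ R ≤ (q ^ R - p ^ R) / (q - p) * x + (q * p ^ R - p * q ^ R) / (q - p) := by
  have hx0 : 0 < x := hp.trans_le hx.1
  have h1 := mul_le_mul_of_nonneg_left (rpow_tangent_le hp hx0 hR) (sub_nonneg.2 hx.2)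
  have h2 := mul_le_mul_of_nonneg_left (rpow_tangent_le (hp.trans hpq) hx0 hR) (sub_nonneg.2 hx.1)
  rw [div_mul_eq_mul_div, ← add_div, le_div_iff₀ (sub_pos.2 hpq)]
  linarith

theorem chord_le_gammaConst {p q x R α : ℝ} (hp : 0 < p) (hpq : p < q) (hR : R < 0)
    (hα : 0 < α) (hx : x ∈ Set.Icc p q) :
    (q ^ R - p ^ R) / (q - p) * x + (q * p ^ R - p * q ^ R) / (q - p) ≤
      α * x ^ R + gammaConst p q R α := by
  have hq : 0 < q := hp.trans hpq
  have hx0 : 0 < x := hp.trans_le hx.1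
  have hsub : 0 < q - p := sub_pos.2 hpq
  set s := (q ^ R - p ^ R) / (α * R * (q - p)) with hs
  set t := s ^ (1 / (R - 1)) with ht
  have hs0 : 0 < s := div_pos_of_neg_of_neg
    (sub_neg.2 (Real.rpow_lt_rpow_of_neg hp hpq hR))
    (mul_neg_of_neg_of_pos (mul_neg_of_pos_of_neg hα hR) hsub)
  have ht0 : 0 < t := Real.rpow_pos_of_pos hs0 _
  have hR1 : R - 1 ≠ 0 := by linarith
  have hts : t ^ (R - 1) = s := by
    rw [ht, ← Real.rpow_mul hs0.le, one_div_mul_cancel hR1, Real.rpow_one]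
  have htR : s ^ (R / (R - 1)) = t ^ R := by
    rw [ht, ← Real.rpow_mul hs0.le, one_div_mul_eq_div]
  have hts' : t ^ R = s * t := by
    rw [← hts, Real.rpow_sub_one ht0.ne', div_mul_cancel₀ _ ht0.ne']
  have hslope : (q ^ R - p ^ R) / (q - p) = α * R * s := by
    have := hR.ne
    rw [hs]; field_simp
  have hchord_p : (q ^ R - p ^ R) / (q - p) * p + (q * p ^ R - p * q ^ R) / (q - p) = p ^ R := by
    field_simp; ring
  have hchord_q : (q ^ R - p ^ R) / (q - p) * q + (q * p ^ R - p * q ^ R) / (q - p) = q ^ R := by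
    field_simp; ring
  rw [hslope] at hchord_p hchord_q ⊢
  have hαR : α * R < 0 := mul_neg_of_pos_of_neg hα hR
  have tangent : ∀ y, 0 < y → α * y ^ R + α * R * y ^ (R - 1) * (x - y) ≤ α * x ^ R :=
      fun y hy => by
    have := mul_le_mul_of_nonneg_left (rpow_tangent_le hx0 hy hR.le) hα.le
    linarith
  unfold gammaConst
  rw [← hs, ← ht, htR]
  split_ifs with h1 h2
  · have := tangent t ht0
    rw [hts, hts'] at this
    rw [hts']
    linarith
  · have := tangent q hq
    have hsq : s ≤ q ^ (R - 1) := hts ▸ Real.rpow_le_rpow_of_nonpos hq h2 (by linarith)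
    have := mul_nonneg (sub_nonneg.2 hx.2) (mul_nonneg (neg_nonneg.2 hαR.le) (sub_nonneg.2 hsq))
    linarith
  · have htp : t ≤ p := by
      by_contra! h
      exact h1 ⟨h.le, (not_le.1 h2).le⟩
    have := tangent p hp
    have hsp : p ^ (R - 1) ≤ s := hts ▸ Real.rpow_le_rpow_of_nonpos ht0 htp (by linarith)
    have := mul_nonneg (sub_nonneg.2 hx.1) (mul_nonneg (neg_nonneg.2 hαR.le) (sub_nonneg.2 hsp))
    linarith

theorem cfc_affine {𝓐 : Type*} [CStarAlgebra 𝓐] (a : 𝓐) (ha : IsSelfAdjoint a) (k b : ℝ) (f : ℝ → ℝ)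
    (hf : ContinuousOn f (spectrum ℝ a)) :
    cfc (fun x => k * f x + b) a = k • cfc f a + b • (1 : 𝓐) := by
  rw [cfc_add_const b (fun x => k * f x) a, cfc_const_mul k f a,
    Algebra.algebraMap_eq_smul_one]

section CStarAlgebra

variable {𝓐 : Type*} [CStarAlgebra 𝓐] [PartialOrder 𝓐] [StarOrderedRing 𝓐]

theorem isStrictlyPositive_of_smul_one_le {c : ℝ} (hc : 0 < c) {a : 𝓐} (ha : c • (1 : 𝓐) ≤ a) :
    IsStrictlyPositive a := by
  have h1 : IsStrictlyPositive (c • (1 : 𝓐)) :=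
    ⟨smul_nonneg hc.le zero_le_one, isUnit_one.smul (Units.mk0 c hc.ne')⟩
  exact ⟨h1.nonneg.trans ha, CStarAlgebra.isUnit_of_le _ ha h1⟩

theorem spectrum_subset_Icc {m M : ℝ} {a : 𝓐} (ha : IsSelfAdjoint a)
    (h1 : m • (1 : 𝓐) ≤ a) (h2 : a ≤ M • (1 : 𝓐)) : spectrum ℝ a ⊆ Set.Icc m M := by
  rw [← Algebra.algebraMap_eq_smul_one] at h1 h2
  exact fun x hx => ⟨(algebraMap_le_iff_le_spectrum ha).1 h1 x hx,
    (le_algebraMap_iff_spectrum_le ha).1 h2 x hx⟩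

theorem smul_one_le_rpow {m M r : ℝ} (hm : 0 < m) {a : 𝓐} (h1 : m • (1 : 𝓐) ≤ a)
    (h2 : a ≤ M • (1 : 𝓐)) (hr : 0 ≤ r) : m ^ r • (1 : 𝓐) ≤ CFC.rpow a r := by
  have ha := isStrictlyPositive_of_smul_one_le hm h1
  have hsp := spectrum_subset_Icc ha.isSelfAdjoint h1 h2
  rw [CFC.rpow_eq_pow, CFC.rpow_eq_cfc_real ha.nonneg, ← Algebra.algebraMap_eq_smul_one]
  exact algebraMap_le_cfc _ _ a (fun x hx => Real.rpow_le_rpow hm.le (hsp hx).1 hr)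
    (continuousOn_id.rpow_const fun x hx => .inl (hm.trans_le (hsp hx).1).ne')

theorem ringInverse_mem_Icc_s5 {m M : ℝ} (hm : 0 < m) {a : 𝓐} (h1 : m • (1 : 𝓐) ≤ a)
    (h2 : a ≤ M • (1 : 𝓐)) :
    (1 / M) • (1 : 𝓐) ≤ Ring.inverse a ∧ Ring.inverse a ≤ (1 / m) • (1 : 𝓐) := by
  have ha := isStrictlyPositive_of_smul_one_le hm h1
  have hsp := spectrum_subset_Icc ha.isSelfAdjoint h1 h2
  have hcont : ContinuousOn (fun x : ℝ => x⁻¹) (spectrum ℝ a) :=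
    continuousOn_id.inv₀ fun x hx => (hm.trans_le (hsp hx).1).ne'
  rw [← cfc_ringInverse_id (R := ℝ) a ha.isUnit ha.isSelfAdjoint,
    ← Algebra.algebraMap_eq_smul_one, ← Algebra.algebraMap_eq_smul_one, one_div, one_div]
  exact ⟨algebraMap_le_cfc _ _ a (fun x hx => inv_anti₀ (hm.trans_le (hsp hx).1) (hsp hx).2) hcont,
    cfc_le_algebraMap _ _ a (fun x hx => inv_anti₀ hm (hsp hx).1) hcont⟩

theorem rpow_le_affine_ringInverse {m M r k b : ℝ} (hm : 0 < m) {a : 𝓐} (h1 : m • (1 : 𝓐) ≤ a)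
    (h2 : a ≤ M • (1 : 𝓐)) (h : ∀ x ∈ Set.Icc m M, x ^ r ≤ k * x⁻¹ + b) :
    CFC.rpow a r ≤ k • Ring.inverse a + b • (1 : 𝓐) := by
  have ha := isStrictlyPositive_of_smul_one_le hm h1
  have hsp := spectrum_subset_Icc ha.isSelfAdjoint h1 h2
  have hne : ∀ x ∈ spectrum ℝ a, x ≠ 0 := fun x hx => (hm.trans_le (hsp hx).1).ne'
  have hcont : ContinuousOn (fun x : ℝ => x⁻¹) (spectrum ℝ a) := continuousOn_id.inv₀ hne
  rw [CFC.rpow_eq_pow, CFC.rpow_eq_cfc_real ha.nonneg,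
    ← cfc_ringInverse_id (R := ℝ) a ha.isUnit ha.isSelfAdjoint,
    ← cfc_affine a ha.isSelfAdjoint k b _ hcont]
  exact cfc_mono (fun x hx => h x (hsp hx))
    (continuousOn_id.rpow_const fun x hx => .inl (hne x hx))
    ((hcont.const_smul k).add continuousOn_const)

theorem affine_le_rpow_ringInverse {p q r k b α γ : ℝ} (hp : 0 < p) {c : 𝓐}
    (h1 : p • (1 : 𝓐) ≤ c) (h2 : c ≤ q • (1 : 𝓐))
    (h : ∀ x ∈ Set.Icc p q, k * x + b ≤ α * x ^ (-r) + γ) :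
    k • c + b • (1 : 𝓐) ≤ α • CFC.rpow (Ring.inverse c) r + γ • (1 : 𝓐) := by
  have hc := isStrictlyPositive_of_smul_one_le hp h1
  have hsp := spectrum_subset_Icc hc.isSelfAdjoint h1 h2
  have hne : ∀ x ∈ spectrum ℝ c, x ≠ 0 := fun x hx => (hp.trans_le (hsp hx).1).ne'
  have hcont : ContinuousOn (fun x : ℝ => x ^ (-r)) (spectrum ℝ c) :=
    continuousOn_id.rpow_const fun x hx => .inl (hne x hx)
  have hinv : CFC.rpow (Ring.inverse c) r = cfc (fun x : ℝ => x ^ (-r)) c := by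
    rw [CFC.inverse_eq_rpow_neg_one hc, CFC.rpow_eq_pow, CFC.rpow_rpow c _ _ (by grind),
      neg_one_mul, CFC.rpow_eq_cfc_real hc.nonneg]
  rw [hinv, ← cfc_affine c hc.isSelfAdjoint α γ _ hcont]
  nth_rw 1 [← cfc_id ℝ c hc.isSelfAdjoint]
  rw [← cfc_affine c hc.isSelfAdjoint k b _ continuousOn_id]
  exact cfc_mono (fun x hx => h x (hsp hx)) (by fun_prop)
    ((hcont.const_smul α).add continuousOn_const)

end CStarAlgebra

theorem stmt5
    {H K : Type*}
    [NormedAddCommGroup H] [InnerProductSpace ℂ H] [CompleteSpace H]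
    [NormedAddCommGroup K] [InnerProductSpace ℂ K] [CompleteSpace K]
    {n : ℕ} (ω : Fin n → ℝ) (hω0 : ∀ j, 0 ≤ ω j) (hω1 : ∑ j, ω j = 1)
    (m M : ℝ) (hm : 0 < m) (hmM : m < M)
    (A : Fin n → (H →L[ℂ] H))
    (hA0 : ∀ j, 0 ≤ A j) (hAu : ∀ j, IsUnit (A j))
    (hA1 : ∀ j, m • (1 : H →L[ℂ] H) ≤ A j)
    (hA2 : ∀ j, A j ≤ M • (1 : H →L[ℂ] H))
    (Φ : (H →L[ℂ] H) →ₗ[ℂ] (K →L[ℂ] K))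
    (hΦ1 : Φ 1 = 1) (hΦpos : ∀ T : H →L[ℂ] H, 0 ≤ T → 0 ≤ Φ T)
    (F : (Fin n → (H →L[ℂ] H)) → (H →L[ℂ] H))
    (G : (Fin n → (K →L[ℂ] K)) → (K →L[ℂ] K))
    (hF : IsAHSandwich ω F) (hG : IsAHSandwich ω G)
    (α : ℝ) (hα : 0 < α) (r : ℝ) (hr : r ∈ Set.Ioc (0 : ℝ) 1)
    :
    G (fun j => Φ (CFC.rpow (A j) r)) ≤
      α • Φ (CFC.rpow (F A) r) + gammaConst (1 / M) (1 / m) (-r) α • (1 : K →L[ℂ] K) := by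
  obtain ⟨hr0, hr1⟩ := hr
  have hM : 0 < M := hm.trans hmM
  have hp : 0 < 1 / M := one_div_pos.2 hM
  have hpq : 1 / M < 1 / m := one_div_lt_one_div_of_lt hm hmM
  set p := 1 / M with hp_def
  set q := 1 / m with hq_def
  set k := (q ^ (-r) - p ^ (-r)) / (q - p) with hk
  set b := (q * p ^ (-r) - p * q ^ (-r)) / (q - p) with hb
  set γ := gammaConst p q (-r) α
  have hΦmono : ∀ S T : H →L[ℂ] H, S ≤ T → Φ S ≤ Φ T := fun S T h => by
    rw [← sub_nonneg, ← map_sub]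
    exact hΦpos _ (sub_nonneg.2 h)
  have hΦsmul : ∀ (c : ℝ) (T : H →L[ℂ] H), Φ (c • T) = c • Φ T :=
    fun c T => Φ.map_smul_of_tower c T
  have hinv := fun j => ringInverse_mem_Icc_s5 hm (hA1 j) (hA2 j)
  set C := ∑ j, ω j • Ring.inverse (A j) with hC
  have hC1 : p • (1 : H →L[ℂ] H) ≤ C := by
    rw [← one_smul ℝ (p • (1 : H →L[ℂ] H)), ← hω1, Finset.sum_smul]
    exact Finset.sum_le_sum fun j _ => smul_le_smul_of_nonneg_left (hinv j).1 (hω0 j)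
  have hC2 : C ≤ q • (1 : H →L[ℂ] H) := by
    rw [← one_smul ℝ (q • (1 : H →L[ℂ] H)), ← hω1, Finset.sum_smul]
    exact Finset.sum_le_sum fun j _ => smul_le_smul_of_nonneg_left (hinv j).2 (hω0 j)
  have hchord : ∀ x ∈ Set.Icc m M, x ^ r ≤ k * x⁻¹ + b := fun x hx => by
    have hx0 : 0 < x := hm.trans_le hx.1
    have := rpow_le_chord hp hpq (neg_nonpos.2 hr0.le) (x := x⁻¹)
      ⟨by rw [hp_def, one_div]; exact inv_anti₀ hx0 hx.2,
        by rw [hq_def, one_div]; exact inv_anti₀ hm hx.1⟩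
    rwa [Real.inv_rpow hx0.le, Real.rpow_neg hx0.le, inv_inv] at this
  have hpow : ∑ j, ω j • CFC.rpow (A j) r ≤ k • C + b • (1 : H →L[ℂ] H) := by
    calc ∑ j, ω j • CFC.rpow (A j) r
        ≤ ∑ j, ω j • (k • Ring.inverse (A j) + b • (1 : H →L[ℂ] H)) :=
          Finset.sum_le_sum fun j _ => smul_le_smul_of_nonneg_left
            (rpow_le_affine_ringInverse hm (hA1 j) (hA2 j) hchord) (hω0 j)
      _ = k • C + b • (1 : H →L[ℂ] H) := by
          simp only [smul_add, Finset.sum_add_distrib, ← Finset.sum_smul, hω1, one_smul, hC,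
            Finset.smul_sum, smul_comm k]
  have hrev : k • C + b • (1 : H →L[ℂ] H) ≤
      α • CFC.rpow (Ring.inverse C) r + γ • (1 : H →L[ℂ] H) :=
    affine_le_rpow_ringInverse hp hC1 hC2 fun x hx =>
      chord_le_gammaConst hp hpq (neg_lt_zero.2 hr0) hα hx
  have hF' : CFC.rpow (Ring.inverse C) r ≤ CFC.rpow (F A) r :=
    CFC.rpow_le_rpow ⟨hr0.le, hr1⟩ (hF A hA0 hAu).2.1
  have hmain : ∑ j, ω j • CFC.rpow (A j) r ≤
      α • CFC.rpow (F A) r + γ • (1 : H →L[ℂ] H) :=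
    hpow.trans (hrev.trans (add_le_add_left (smul_le_smul_of_nonneg_left hF' hα.le) _))
  have hΦA : ∀ j, IsStrictlyPositive (Φ (CFC.rpow (A j) r)) := fun j =>
    isStrictlyPositive_of_smul_one_le (Real.rpow_pos_of_pos hm r) <| by
      rw [← hΦ1, ← hΦsmul]
      exact hΦmono _ _ (smul_one_le_rpow hm (hA1 j) (hA2 j) hr0.le)
  calc G (fun j => Φ (CFC.rpow (A j) r))
      ≤ ∑ j, ω j • Φ (CFC.rpow (A j) r) :=
        (hG _ (fun j => (hΦA j).nonneg) (fun j => (hΦA j).isUnit)).2.2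
    _ = Φ (∑ j, ω j • CFC.rpow (A j) r) := by simp only [map_sum, hΦsmul]
    _ ≤ Φ (α • CFC.rpow (F A) r + γ • (1 : H →L[ℂ] H)) := hΦmono _ _ hmain
    _ = α • Φ (CFC.rpow (F A) r) + γ • (1 : K →L[ℂ] K) := by
        rw [map_add, hΦsmul, hΦsmul, hΦ1]
end
end

section
/- Let A₁, …, Aₙ be positive invertible operators on H with mI ≤ Aⱼ ≤ MI (j = 1, …, n) for some scalars 0 < m < M, let Φ : B(H) → B(K) be a unital positive linear map, let h = M/m, and let F (on H) and G (on K) each satisfy the arithmetic–harmonic sandwich for the probability vector ω. Then for every r ∈ (0, 1), G(Φ(A₁ʳ), …, Φ(Aₙʳ)) ≤ K(h, −r)·Φ(F(A₁, …, Aₙ)ʳ). -/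
noncomputable section

/-- The generalized Kantorovich constant `K(h, p)`, with `K(h, 0) = K(h, 1) = 1`. -/
def Kconst (h p : ℝ) : ℝ :=
  if p = 0 ∨ p = 1 then 1
  else ((h ^ p - h) / ((p - 1) * (h - 1))) *
    (((p - 1) / p) * ((h ^ p - 1) / (h ^ p - h))) ^ p

/-- The slope of the chord of `x ↦ x ^ (1 + r)` over `[m, M]`. -/
def chordSlope (m M r : ℝ) : ℝ := (M * M ^ r - m * m ^ r) / (M - m)

/-- The negative of the intercept of the chord of `x ↦ x ^ (1 + r)` over `[m, M]`. -/
def chordIntercept (m M r : ℝ) : ℝ := m * M * (M ^ r - m ^ r) / (M - m)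

section Scalar

variable {m M r : ℝ}

lemma chordIntercept_pos (hm : 0 < m) (hmM : m < M) (hr : 0 < r) : 0 < chordIntercept m M r := by
  have hM := hm.trans hmM
  have h := Real.rpow_lt_rpow hm.le hmM hr
  exact div_pos (mul_pos (mul_pos hm hM) (sub_pos.2 h)) (sub_pos.2 hmM)

lemma chordSlope_pos (hm : 0 < m) (hmM : m < M) (hr : 0 < r) : 0 < chordSlope m M r := by
  have h := Real.rpow_lt_rpow hm.le hmM hr
  have hp := Real.rpow_pos_of_pos hm r
  exact div_pos (sub_pos.2 (mul_lt_mul hmM h.le hp (hm.trans hmM).le)) (sub_pos.2 hmM)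

lemma Kconst_neg_eq (hm : 0 < m) (hmM : m < M) (hr : 0 < r) :
    Kconst (M / m) (-r) = chordSlope m M r / (1 + r) *
      (chordIntercept m M r * (1 + r) / (r * chordSlope m M r)) ^ (-r) := by
  have hM := hm.trans hmM
  have hβ := chordSlope_pos hm hmM hr
  have ha := chordIntercept_pos hm hmM hr
  have hq := Real.rpow_pos_of_pos hM r
  have hp := Real.rpow_pos_of_pos hm r
  have hd := sub_pos.2 hmM
  have hpq : 0 < M * M ^ r - m * m ^ r := by
    rw [chordSlope] at hβ
    exact (div_pos_iff_of_pos_right hd).1 hβ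
  have hrp : (M / m) ^ (-r) = m ^ r / M ^ r := by
    rw [Real.rpow_neg (by positivity), Real.div_rpow hM.le hm.le, inv_div]
  have hne : ¬ (-r = 0 ∨ -r = 1) := by
    rintro (h | h) <;> linarith
  have hd1 : M / m - 1 = (M - m) / m := by field_simp
  have hd2 : m ^ r / M ^ r - M / m = -((M * M ^ r - m * m ^ r) / (m * M ^ r)) := by
    field_simp
    ring
  have hfst : (m ^ r / M ^ r - M / m) / ((-r - 1) * (M / m - 1))
      = chordSlope m M r / (1 + r) / M ^ r := by
    rw [hd1, hd2, chordSlope, show -r - 1 = -(1 + r) by ring]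
    field_simp
  have hsnd : (-r - 1) / (-r) * ((m ^ r / M ^ r - 1) / (m ^ r / M ^ r - M / m))
      = chordIntercept m M r * (1 + r) / (r * chordSlope m M r) / M := by
    rw [hd2, chordSlope, chordIntercept, show -r - 1 = -(1 + r) by ring]
    field_simp
    ring
  rw [Kconst, if_neg hne, hrp, hfst, hsnd, Real.div_rpow (by positivity) hM.le,
    Real.rpow_neg hM.le]
  field_simp

lemma Kconst_neg_nonneg (hm : 0 < m) (hmM : m < M) (hr : 0 < r) : 0 ≤ Kconst (M / m) (-r) := by
  have hβ := chordSlope_pos hm hmM hr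
  have ha := chordIntercept_pos hm hmM hr
  rw [Kconst_neg_eq hm hmM hr]
  positivity

lemma one_add_sub_mul_inv_le_rpow {z : ℝ} (hz : 0 < z) (hr : 0 ≤ r) :
    1 + r - r * z⁻¹ ≤ z ^ r := by
  have h := mul_le_mul_of_nonneg_left (Real.one_sub_inv_le_log_of_pos hz) hr
  have h' := Real.add_one_le_exp (Real.log z * r)
  rw [Real.rpow_def_of_pos hz]
  linarith

lemma chord_le_Kconst_mul_rpow (hm : 0 < m) (hmM : m < M) (hr : 0 < r) {x : ℝ} (hx : 0 < x) :
    -chordIntercept m M r * x⁻¹ + chordSlope m M r ≤ Kconst (M / m) (-r) * x ^ r := by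
  have hβ := chordSlope_pos hm hmM hr
  have ha := chordIntercept_pos hm hmM hr
  rw [Kconst_neg_eq hm hmM hr]
  set a := chordIntercept m M r
  set b := chordSlope m M r
  have hc : 0 < a * (1 + r) / (r * b) := by positivity
  have h := mul_le_mul_of_nonneg_left (one_add_sub_mul_inv_le_rpow (div_pos hx hc) hr.le)
    (show 0 ≤ b / (1 + r) by positivity)
  rw [Real.div_rpow hx.le hc.le] at h
  rw [Real.rpow_neg hc.le]
  calc -a * x⁻¹ + b
      = b / (1 + r) * (1 + r - r * (x / (a * (1 + r) / (r * b)))⁻¹) := by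
        field_simp
        ring
    _ ≤ _ := h
    _ = _ := by ring

lemma rpow_le_chord_s7 (hm : 0 < m) (hmM : m < M) (hr : 0 < r) {x : ℝ} (hmx : m ≤ x) (hxM : x ≤ M) :
    x ^ r ≤ -chordIntercept m M r * x⁻¹ + chordSlope m M r := by
  have hM := hm.trans hmM
  have hx := hm.trans_le hmx
  have hd := sub_pos.2 hmM
  have h := (convexOn_rpow (p := 1 + r) (by linarith)).2 hm.le hM.le
    (div_nonneg (sub_nonneg.2 hxM) hd.le) (div_nonneg (sub_nonneg.2 hmx) hd.le)
    (by field_simp; ring)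
  have hcomb : (M - x) / (M - m) * m + (x - m) / (M - m) * M = x := by
    field_simp
    ring
  simp only [smul_eq_mul] at h
  rw [hcomb, Real.rpow_add hx, Real.rpow_add hm, Real.rpow_add hM] at h
  simp only [Real.rpow_one] at h
  refine le_of_mul_le_mul_left (h.trans_eq ?_) hx
  rw [chordSlope, chordIntercept]
  field_simp
  ring

end Scalar

section CStarAlgebra

variable {𝔄 : Type*} [CStarAlgebra 𝔄] [PartialOrder 𝔄] [StarOrderedRing 𝔄]

lemma cfc_mul_inv_add_const {a : 𝔄} (ha : IsStrictlyPositive a) (α β : ℝ) :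
    cfc (fun x : ℝ => α * x⁻¹ + β) a = α • Ring.inverse a + β • (1 : 𝔄) := by
  have hsa := ha.isSelfAdjoint
  have h0 : ∀ x ∈ spectrum ℝ a, x ≠ 0 := fun x hx => (ha.spectrum_pos hx).ne'
  have hinv : ContinuousOn (fun x : ℝ => x⁻¹) (spectrum ℝ a) := continuousOn_inv₀.mono h0
  rw [cfc_add_const β (fun x => α * x⁻¹) a (continuousOn_const.mul hinv),
    cfc_const_mul α (fun x => x⁻¹) a hinv, cfc_inv (fun x : ℝ => x) a h0, cfc_id' ℝ a,
    Algebra.algebraMap_eq_smul_one]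

lemma continuousOn_rpow_spectrum {a : 𝔄} (ha : IsStrictlyPositive a) (r : ℝ) :
    ContinuousOn (fun x : ℝ => x ^ r) (spectrum ℝ a) :=
  fun _ hx => (Real.continuousAt_rpow_const _ _ (.inl (ha.spectrum_pos hx).ne')).continuousWithinAt

lemma continuousOn_mul_inv_add_const_spectrum {a : 𝔄} (ha : IsStrictlyPositive a) (α β : ℝ) :
    ContinuousOn (fun x : ℝ => α * x⁻¹ + β) (spectrum ℝ a) :=
  (continuousOn_const.mul (continuousOn_inv₀.mono fun _ hx => (ha.spectrum_pos hx).ne')).add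
    continuousOn_const

variable {m M r : ℝ}

lemma cfcRpow_le_chord (hm : 0 < m) (hmM : m < M) (hr : 0 < r) {a : 𝔄}
    (ha : IsStrictlyPositive a) (hma : m • (1 : 𝔄) ≤ a) (haM : a ≤ M • (1 : 𝔄)) :
    CFC.rpow a r ≤ -chordIntercept m M r • Ring.inverse a + chordSlope m M r • (1 : 𝔄) := by
  have hsa := ha.isSelfAdjoint
  rw [← Algebra.algebraMap_eq_smul_one] at hma haM
  rw [← cfc_mul_inv_add_const ha]
  change a ^ r ≤ _
  rw [CFC.rpow_eq_cfc_real ha.nonneg]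
  exact cfc_mono (fun x hx => rpow_le_chord_s7 hm hmM hr
    ((algebraMap_le_iff_le_spectrum hsa).1 hma x hx)
    ((le_algebraMap_iff_spectrum_le hsa).1 haM x hx))
    (continuousOn_rpow_spectrum ha r) (continuousOn_mul_inv_add_const_spectrum ha _ _)

lemma chord_le_Kconst_smul_cfcRpow (hm : 0 < m) (hmM : m < M) (hr : 0 < r) {a : 𝔄}
    (ha : IsStrictlyPositive a) :
    -chordIntercept m M r • Ring.inverse a + chordSlope m M r • (1 : 𝔄) ≤
      Kconst (M / m) (-r) • CFC.rpow a r := by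
  rw [← cfc_mul_inv_add_const ha]
  change _ ≤ _ • a ^ r
  rw [CFC.rpow_eq_cfc_real ha.nonneg, ← cfc_const_mul _ _ a (continuousOn_rpow_spectrum ha r)]
  exact cfc_mono (fun x hx => chord_le_Kconst_mul_rpow hm hmM hr (ha.spectrum_pos hx))
    (continuousOn_mul_inv_add_const_spectrum ha _ _)
    (continuousOn_const.mul (continuousOn_rpow_spectrum ha r))

lemma isStrictlyPositive_sum_smul {ι : Type*} [Fintype ι] {ω : ι → ℝ} (hω0 : ∀ j, 0 ≤ ω j)
    (hω1 : ∑ j, ω j = 1) {B : ι → 𝔄} (hB : ∀ j, IsStrictlyPositive (B j)) :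
    IsStrictlyPositive (∑ j, ω j • B j) := by
  obtain ⟨j, -, hj⟩ : ∃ j ∈ Finset.univ, ω j ≠ 0 :=
    Finset.exists_ne_zero_of_sum_ne_zero (by simp [hω1])
  exact ((hB j).smul ((hω0 j).lt_of_ne' hj)).of_le
    (Finset.single_le_sum (f := fun j => ω j • B j)
      (fun i _ => smul_nonneg (hω0 i) (hB i).nonneg) (Finset.mem_univ j))

/-- A converse of the convexity inequality for negative powers, of Mond–Pečarić type. -/
lemma sum_smul_cfcRpow_le_Kconst_smul {ι : Type*} [Fintype ι] {ω : ι → ℝ}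
    (hω0 : ∀ j, 0 ≤ ω j) (hω1 : ∑ j, ω j = 1) (hm : 0 < m) (hmM : m < M) (hr : 0 < r)
    {A : ι → 𝔄} (hA : ∀ j, IsStrictlyPositive (A j)) (hmA : ∀ j, m • (1 : 𝔄) ≤ A j)
    (hAM : ∀ j, A j ≤ M • (1 : 𝔄)) :
    ∑ j, ω j • CFC.rpow (A j) r ≤ Kconst (M / m) (-r) •
      CFC.rpow (Ring.inverse (∑ j, ω j • Ring.inverse (A j))) r := by
  have hT : IsStrictlyPositive (∑ j, ω j • Ring.inverse (A j)) :=
    isStrictlyPositive_sum_smul hω0 hω1 fun j => (hA j).ringInverse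
  refine le_trans (Finset.sum_le_sum fun j _ => smul_le_smul_of_nonneg_left
    (cfcRpow_le_chord hm hmM hr (hA j) (hmA j) (hAM j)) (hω0 j)) ?_
  refine le_trans (le_of_eq ?_) (chord_le_Kconst_smul_cfcRpow hm hmM hr hT.ringInverse)
  simp only [smul_add, Finset.sum_add_distrib, ← Finset.sum_smul, smul_smul, ← Finset.sum_mul,
    hω1, one_mul, Ring.inverse_inverse hT.isUnit]
  simp only [Finset.smul_sum, smul_smul, mul_comm]

lemma rpow_smul_one_le_cfcRpow (hm : 0 < m) (hr : 0 ≤ r) {a : 𝔄}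
    (ha : IsStrictlyPositive a) (hma : m • (1 : 𝔄) ≤ a) : m ^ r • (1 : 𝔄) ≤ CFC.rpow a r := by
  have hsa := ha.isSelfAdjoint
  rw [← Algebra.algebraMap_eq_smul_one] at hma ⊢
  change _ ≤ a ^ r
  rw [CFC.rpow_eq_cfc_real ha.nonneg]
  exact algebraMap_le_cfc _ _ a (fun x hx => Real.rpow_le_rpow hm.le
    ((algebraMap_le_iff_le_spectrum hsa).1 hma x hx) hr) (continuousOn_rpow_spectrum ha r)

end CStarAlgebra

theorem stmt7
    {H K : Type*}
    [NormedAddCommGroup H] [InnerProductSpace ℂ H] [CompleteSpace H]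
    [NormedAddCommGroup K] [InnerProductSpace ℂ K] [CompleteSpace K]
    {n : ℕ} (ω : Fin n → ℝ) (hω0 : ∀ j, 0 ≤ ω j) (hω1 : ∑ j, ω j = 1)
    (m M : ℝ) (hm : 0 < m) (hmM : m < M)
    (A : Fin n → (H →L[ℂ] H))
    (hA0 : ∀ j, 0 ≤ A j) (hAu : ∀ j, IsUnit (A j))
    (hA1 : ∀ j, m • (1 : H →L[ℂ] H) ≤ A j)
    (hA2 : ∀ j, A j ≤ M • (1 : H →L[ℂ] H))
    (Φ : (H →L[ℂ] H) →ₗ[ℂ] (K →L[ℂ] K))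
    (hΦ1 : Φ 1 = 1) (hΦpos : ∀ T : H →L[ℂ] H, 0 ≤ T → 0 ≤ Φ T)
    (F : (Fin n → (H →L[ℂ] H)) → (H →L[ℂ] H))
    (G : (Fin n → (K →L[ℂ] K)) → (K →L[ℂ] K))
    (hF : IsAHSandwich ω F) (hG : IsAHSandwich ω G)
    (r : ℝ) (hr : r ∈ Set.Ioo (0 : ℝ) 1)
    :
    G (fun j => Φ (CFC.rpow (A j) r)) ≤ Kconst (M / m) (-r) • Φ (CFC.rpow (F A) r) := by
  have hr0 := hr.1
  have hA : ∀ j, IsStrictlyPositive (A j) := fun j => (hAu j).isStrictlyPositive (hA0 j)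
  have hΦsmul (c : ℝ) (T : H →L[ℂ] H) : Φ (c • T) = c • Φ T := Φ.map_smul_of_tower c T
  have hΦmono {S T : H →L[ℂ] H} (h : S ≤ T) : Φ S ≤ Φ T := by
    have := hΦpos _ (sub_nonneg.2 h)
    rwa [map_sub, sub_nonneg] at this
  have hΦA (j) : IsStrictlyPositive (Φ (CFC.rpow (A j) r)) := by
    have h := hΦmono (rpow_smul_one_le_cfcRpow hm hr0.le (hA j) (hA1 j))
    rw [hΦsmul, hΦ1] at h
    exact (isStrictlyPositive_one.smul (Real.rpow_pos_of_pos hm r)).of_le h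
  have hmean := (hF A hA0 hAu).2.1
  have hpow : CFC.rpow (Ring.inverse (∑ j, ω j • Ring.inverse (A j))) r ≤ CFC.rpow (F A) r :=
    CFC.rpow_le_rpow ⟨hr0.le, hr.2.le⟩ hmean
  calc G (fun j => Φ (CFC.rpow (A j) r))
      ≤ ∑ j, ω j • Φ (CFC.rpow (A j) r) :=
        (hG _ (fun j => (hΦA j).nonneg) (fun j => (hΦA j).isUnit)).2.2
    _ = Φ (∑ j, ω j • CFC.rpow (A j) r) := by simp only [map_sum, hΦsmul]
    _ ≤ Φ (Kconst (M / m) (-r) • CFC.rpow (F A) r) :=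
        hΦmono <| (sum_smul_cfcRpow_le_Kconst_smul hω0 hω1 hm hmM hr0 hA hA1 hA2).trans <|
          smul_le_smul_of_nonneg_left hpow (Kconst_neg_nonneg hm hmM hr0)
    _ = Kconst (M / m) (-r) • Φ (CFC.rpow (F A) r) := hΦsmul _ _
end
end
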